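/- Every maximal nested set on a diagram D has cardinality equal to the number of vertices |V(D)| of D. -/

import Mathlib

namespace DiagramStmt

variable {V : Type*} [Fintype V] [DecidableEq V]

/-- Two subdiagrams (identified with their vertex sets) are orthogonal:
their vertex sets are disjoint and no edge of `G` joins them. -/
def Orth (G : SimpleGraph V) (B₁ B₂ : Finset V) : Prop :=
  Disjoint B₁ B₂ ∧ ∀ i ∈ B₁, ∀ j ∈ B₂, ¬ G.Adj i j

/-- Two subdiagrams are compatible if one contains the other or they are orthogonal. -/
def Compat (G : SimpleGraph V) (B₁ B₂ : Finset V) : Prop :=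
  B₁ ⊆ B₂ ∨ B₂ ⊆ B₁ ∨ Orth G B₁ B₂

/-- A subdiagram is connected if its induced graph is connected. -/
def Conn (G : SimpleGraph V) (B : Finset V) : Prop :=
  (G.induce (↑B : Set V)).Connected

/-- `B` is a connected component of the subdiagram `D` of `G`: it is a maximal
connected subset of `D`. -/
def IsComponentOn (G : SimpleGraph V) (D B : Finset V) : Prop :=
  B ⊆ D ∧ Conn G B ∧ ∀ C, C ⊆ D → Conn G C → B ⊆ C → C = B

/-- `H` is a nested set on the subdiagram `D` of `G`: a collection of pairwise
compatible connected subdiagrams of `D` containing all connected components of `D`. -/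
def IsNestedSetOn (G : SimpleGraph V) (D : Finset V) (H : Finset (Finset V)) : Prop :=
  (∀ B ∈ H, B ⊆ D) ∧ (∀ B ∈ H, Conn G B) ∧
    (∀ B₁ ∈ H, ∀ B₂ ∈ H, Compat G B₁ B₂) ∧
    ∀ B, IsComponentOn G D B → B ∈ H

/-- A maximal nested set on `D`. -/
def IsMaxNestedSetOn (G : SimpleGraph V) (D : Finset V) (H : Finset (Finset V)) : Prop :=
  IsNestedSetOn G D H ∧ ∀ H', IsNestedSetOn G D H' → H ⊆ H' → H' = H

lemma Orth.symm {α : Type*} {G : SimpleGraph α} {A B : Finset α} (h : Orth G A B) : Orth G B A :=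
  ⟨h.1.symm, fun i hi j hj hij => h.2 j hj i hi hij.symm⟩

lemma Orth.mono_right {α : Type*} {G : SimpleGraph α} {A B C : Finset α} (h : Orth G A B)
    (hC : C ⊆ B) : Orth G A C :=
  ⟨h.1.mono_right hC, fun i hi j hj => h.2 i hi j (hC hj)⟩

lemma Compat.symm {α : Type*} {G : SimpleGraph α} {A B : Finset α} (h : Compat G A B) :
    Compat G B A := by
  rcases h with h | h | h
  exacts [.inr (.inl h), .inl h, .inr (.inr h.symm)]

lemma Compat.subset_or_subset {α : Type*} {G : SimpleGraph α} {A B : Finset α} (h : Compat G A B)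
    {v : α} (hA : v ∈ A) (hB : v ∈ B) : A ⊆ B ∨ B ⊆ A := by
  rcases h with h | h | h
  exacts [.inl h, .inr h, (Finset.disjoint_left.1 h.1 hA hB).elim]

lemma Conn.nonempty {α : Type*} {G : SimpleGraph α} {B : Finset α} (h : Conn G B) : B.Nonempty := by
  obtain ⟨v, hv⟩ := SimpleGraph.Connected.nonempty h
  exact ⟨v, hv⟩

lemma conn_singleton {α : Type*} (G : SimpleGraph α) (v : α) : Conn G {v} := by
  have : Subsingleton ((({v} : Finset α) : Set α)) := by
    rw [Finset.coe_singleton]; infer_instance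
  have : Nonempty ((({v} : Finset α) : Set α)) := ⟨⟨v, by simp⟩⟩
  exact SimpleGraph.Connected.of_subsingleton

lemma Conn.union {α : Type*} [DecidableEq α] {G : SimpleGraph α} {A B : Finset α}
    (hA : Conn G A) (hB : Conn G B) (h : ¬ Orth G A B) : Conn G (A ∪ B) := by
  unfold Conn at *
  rw [Finset.coe_union]
  by_cases hd : Disjoint A B
  · simp only [Orth, hd, true_and, not_forall, not_not] at h
    obtain ⟨i, hi, j, hj, hij⟩ := h
    exact SimpleGraph.connected_induce_union hA.preconnected hB.preconnected hi hj hij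
  · obtain ⟨v, hvA, hvB⟩ := Finset.not_disjoint_iff.1 hd
    exact SimpleGraph.induce_union_connected hA.preconnected hB.preconnected ⟨v, hvA, hvB⟩

lemma Conn.exists_adj {α : Type*} {G : SimpleGraph α} {A B : Finset α} (hB : Conn G B)
    (hA : A.Nonempty) (hAB : A ⊂ B) : ∃ a ∈ A, ∃ b ∈ B, b ∉ A ∧ G.Adj a b := by
  obtain ⟨u, hu⟩ := hA
  obtain ⟨w, hw, hwA⟩ := Finset.exists_of_ssubset hAB
  obtain ⟨p⟩ := hB.preconnected ⟨u, hAB.1 hu⟩ ⟨w, hw⟩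
  obtain ⟨d, -, h₁, h₂⟩ := p.exists_boundary_dart {x | (x : α) ∈ A} hu hwA
  exact ⟨_, h₁, _, d.snd.2, h₂, d.adj⟩

lemma exists_isComponentOn {α : Type*} [Finite α] (G : SimpleGraph α) {D : Finset α} {v : α}
    (hv : v ∈ D) : ∃ C, IsComponentOn G D C ∧ v ∈ C := by
  obtain ⟨C, hvC, hC⟩ := Finite.exists_le_maximal (p := fun C => C ⊆ D ∧ Conn G C)
    (a := {v}) ⟨by simpa using hv, conn_singleton G v⟩
  exact ⟨C, ⟨hC.prop.1, hC.prop.2, fun E hED hE hCE => (hC.eq_of_le ⟨hED, hE⟩ hCE).symm⟩,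
    hvC (Finset.mem_singleton_self v)⟩

lemma IsComponentOn.subset_or_orth {α : Type*} [DecidableEq α] {G : SimpleGraph α}
    {D A C : Finset α} (hC : IsComponentOn G D C) (hAD : A ⊆ D) (hA : Conn G A) :
    A ⊆ C ∨ Orth G A C := by
  by_contra! h
  refine h.1 (Finset.union_eq_right.1 ?_)
  exact hC.2.2 _ (Finset.union_subset hAD hC.1) (hA.union hC.2.1 h.2) Finset.subset_union_right

lemma IsNestedSetOn.exists_least {α : Type*} [Finite α] {G : SimpleGraph α} {D : Finset α}
    {H : Finset (Finset α)} (hH : IsNestedSetOn G D H) {v : α} (hv : v ∈ D) :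
    ∃ B ∈ H, v ∈ B ∧ ∀ A ∈ H, v ∈ A → B ⊆ A := by
  obtain ⟨C, hC, hvC⟩ := exists_isComponentOn G hv
  obtain ⟨B, -, hB⟩ := Finite.exists_le_minimal (p := fun B => B ∈ H ∧ v ∈ B)
    (a := C) ⟨hH.2.2.2 C hC, hvC⟩
  refine ⟨B, hB.prop.1, hB.prop.2, fun A hA hvA => ?_⟩
  rcases (hH.2.2.1 B hB.prop.1 A hA).subset_or_subset hB.prop.2 hvA with h | h
  exacts [h, hB.le_of_le ⟨hA, hvA⟩ h]

/-- A member of a nested set is not covered by the smaller members. -/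
lemma IsNestedSetOn.exists_mem_forall_subset {α : Type*} [Finite α]
    {G : SimpleGraph α} {D : Finset α} {H : Finset (Finset α)} (hH : IsNestedSetOn G D H)
    {B : Finset α} (hB : B ∈ H) :
    ∃ v ∈ B, ∀ A ∈ H, v ∈ A → B ⊆ A := by
  by_contra! hcon
  have key : ∀ v ∈ B, ∃ A ∈ H, v ∈ A ∧ A ⊂ B := by
    intro v hv
    obtain ⟨A, hA, hvA, hBA⟩ := hcon v hv
    rcases (hH.2.2.1 B hB A hA).subset_or_subset hv hvA with h | h
    exacts [(hBA h).elim, ⟨A, hA, hvA, h, hBA⟩]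
  obtain ⟨u, hu⟩ := (hH.2.1 B hB).nonempty
  obtain ⟨A₀, hA₀, -, hA₀B⟩ := key u hu
  obtain ⟨A, -, hA⟩ := Finite.exists_le_maximal (p := fun A => A ∈ H ∧ A ⊂ B)
    (a := A₀) ⟨hA₀, hA₀B⟩
  obtain ⟨a, ha, b, hb, hbA, hab⟩ :=
    (hH.2.1 B hB).exists_adj (hH.2.1 A hA.prop.1).nonempty hA.prop.2
  obtain ⟨E, hE, hbE, hEB⟩ := key b hb
  rcases hH.2.2.1 A hA.prop.1 E hE with h | h | h
  exacts [hbA (hA.le_of_ge ⟨hE, hEB⟩ h hbE), hbA (h hbE), h.2 a ha b hbE hab]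

/-- In a maximal nested set, each member is the least member containing `v` for at most
one vertex `v`. -/
lemma IsMaxNestedSetOn.eq_of_least {G : SimpleGraph V} {D : Finset V} {H : Finset (Finset V)}
    (hH : IsMaxNestedSetOn G D H) {B : Finset V} (hB : B ∈ H) {v w : V} (hv : v ∈ B)
    (hw : w ∈ B) (hvB : ∀ A ∈ H, v ∈ A → B ⊆ A) (hwB : ∀ A ∈ H, w ∈ A → B ⊆ A) : v = w := by
  by_contra hvw
  obtain ⟨hN, hmax⟩ := hH
  obtain ⟨C, hC, hvC⟩ := exists_isComponentOn G (Finset.mem_erase.2 ⟨hvw, hv⟩)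
  have hCB : C ⊆ B := hC.1.trans (Finset.erase_subset _ _)
  have hwC : w ∉ C := fun h => Finset.notMem_erase w B (hC.1 h)
  have hcompat : ∀ A ∈ H, Compat G A C := by
    intro A hA
    rcases hN.2.2.1 A hA B hB with h | h | h
    · by_cases hwA : w ∈ A
      · exact .inr (.inl (hCB.trans (hwB A hA hwA)))
      · rcases hC.subset_or_orth (Finset.subset_erase.2 ⟨h, hwA⟩) (hN.2.1 A hA) with h | h
        exacts [.inl h, .inr (.inr h)]
    · exact .inr (.inl (hCB.trans h))
    · exact .inr (.inr (h.mono_right hCB))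
  have hN' : IsNestedSetOn G D (insert C H) := by
    refine ⟨?_, ?_, ?_, fun A hA => Finset.mem_insert_of_mem (hN.2.2.2 A hA)⟩
    · exact (Finset.forall_mem_insert _ _ _).2 ⟨hCB.trans (hN.1 B hB), hN.1⟩
    · exact (Finset.forall_mem_insert _ _ _).2 ⟨hC.2.1, hN.2.1⟩
    · intro A₁ hA₁ A₂ hA₂
      rcases Finset.mem_insert.1 hA₁ with rfl | h₁ <;>
        rcases Finset.mem_insert.1 hA₂ with rfl | h₂
      exacts [.inl subset_rfl, (hcompat _ h₂).symm, hcompat _ h₁, hN.2.2.1 _ h₁ _ h₂]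
  have hCH : C ∈ H := hmax _ hN' (Finset.subset_insert C H) ▸ Finset.mem_insert_self C H
  exact hwC (hvB C hCH hvC hw)

/-- every maximal nested set on `D` has cardinality `|V(D)|`. -/
theorem maxNestedSet_card (G : SimpleGraph V) (H : Finset (Finset V))
    (hH : IsMaxNestedSetOn G Finset.univ H) :
    H.card = Fintype.card V := by
  choose m hmH hmem hmin using fun v => hH.1.exists_least (Finset.mem_univ v)
  symm
  refine Finset.card_bij (fun v _ => m v) (fun v _ => hmH v) ?_ ?_
  · intro v _ w _ h
    exact hH.eq_of_least (hmH v) (hmem v) (h ▸ hmem w) (hmin v) (h ▸ hmin w)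
  · intro B hB
    obtain ⟨v, hv, hvB⟩ := hH.1.exists_mem_forall_subset hB
    exact ⟨v, Finset.mem_univ v, (hmin v B hB hv).antisymm (hvB _ (hmH v) (hmem v))⟩

end DiagramStmt
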